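/- For every s ∈ ℕ and every q ∈ ℍ[ℚ₂, 2, 5]: (a) there exists p ∈ O_D with q = i^(2s)·p if and only if q = a + b·ω + c·i + d·(i·ω) with a, b, c, d ∈ 2^s·ℤ₂; and (b) there exists p ∈ O_D with q = i^(2s+1)·p if and only if q = a + b·ω + c·i + d·(i·ω) with a, b ∈ 2^(s+1)·ℤ₂ and c, d ∈ 2^s·ℤ₂. (This is the coordinate description of the two-sided ideals i^t·O_D underlying the ring isomorphisms O_D/i^(2s)O_D ≅ (ℤ₂/2^s)·1 ⊕ (ℤ₂/2^s)·ω ⊕ (ℤ₂/2^s)·i ⊕ (ℤ₂/2^s)·iω and O_D/i^(2s+1)O_D ≅ (ℤ₂/2^(s+1))·1 ⊕ (ℤ₂/2^(s+1))·ω ⊕ (ℤ₂/2^s)·i ⊕ (ℤ₂/2^s)·iω.) -/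

import Mathlib

open Quaternion

noncomputable section

/-- `D` is the quaternion algebra `ℍ[ℚ₂, 2, 5]` with `i² = 2`, `j² = 5`, `i·j = -j·i`;
this is the unique quaternion division algebra over `ℚ₂`. -/
abbrev D : Type := ℍ[ℚ_[2], 2, 5]

/-- The basis quaternion `i`. -/
def qi : D := ⟨0, 1, 0, 0⟩

/-- The basis quaternion `j`. -/
def qj : D := ⟨0, 0, 1, 0⟩

/-- `ω = (1 + j)/2`. -/
def qω : D := ⟨1/2, 0, 1/2, 0⟩

/-- The reduced norm `N(q) = q · (star q)` (as a scalar). -/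
def qN (q : D) : ℚ_[2] := (q * star q).re

/-- The reduced trace `T(q) = q + star q = 2·q.re` (as a scalar). -/
def qT (q : D) : ℚ_[2] := 2 * q.re

def mkq (a b c d : ℚ_[2]) : D := algebraMap ℚ_[2] D a + algebraMap ℚ_[2] D b * qω +
            algebraMap ℚ_[2] D c * qi + algebraMap ℚ_[2] D d * (qi * qω)

lemma mkq_eq (a b c d : ℚ_[2]) : mkq a b c d = ⟨a + b/2, c + d/2, b/2, d/2⟩ := by
  simp only [mkq, QuaternionAlgebra.algebraMap_eq, qω, qi]
  ext <;> simp <;> ring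

lemma mkq_surj (p : D) : ∃ a b c d, p = mkq a b c d := by
  refine ⟨p.re - p.imJ, 2 * p.imJ, p.imI - p.imK, 2 * p.imK, ?_⟩
  rw [mkq_eq]
  ext <;> simp

lemma qN_mkq (a b c d : ℚ_[2]) :
    qN (mkq a b c d) = (a * (a + b) - b * b) - 2 * (c * (c + d) - d * d) := by
  rw [mkq_eq, qN]
  simp
  ring

lemma norm_add_lt {a b : ℚ_[2]} (hb : b ≠ 0) (h : ‖a‖ = ‖b‖) : ‖a + b‖ < ‖b‖ := by
  have ht : ‖a / b‖ = 1 := by rw [norm_div, h, div_self (norm_ne_zero_iff.2 hb)]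
  let t : ℤ_[2] := ⟨a / b, ht.le⟩
  have h1 : PadicInt.toZMod (t + 1) = 0 := by
    have : PadicInt.toZMod t ≠ 0 := by
      intro h0
      have : t ∈ RingHom.ker (PadicInt.toZMod (p := 2)) := h0
      rw [PadicInt.ker_toZMod, IsLocalRing.mem_maximalIdeal, PadicInt.mem_nonunits] at this
      exact absurd ht this.ne
    rw [map_add, map_one]
    revert this
    generalize PadicInt.toZMod t = z
    revert z
    decide
  have h2 : t + 1 ∈ RingHom.ker (PadicInt.toZMod (p := 2)) := h1
  rw [PadicInt.ker_toZMod, IsLocalRing.mem_maximalIdeal, PadicInt.mem_nonunits] at h2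
  have h3 : ‖a / b + 1‖ < 1 := h2
  have : a + b = (a / b + 1) * b := by field_simp
  rw [this, norm_mul]
  nlinarith [norm_pos_iff.2 hb]

lemma norm_form (a b : ℚ_[2]) : ∃ m : ℚ_[2], ‖a‖ ≤ ‖m‖ ∧ ‖b‖ ≤ ‖m‖ ∧ (m = a ∨ m = b) ∧
    ‖a * (a + b) - b * b‖ = ‖m‖ ^ 2 := by
  rcases lt_trichotomy ‖a‖ ‖b‖ with h | h | h
  · refine ⟨b, h.le, le_rfl, .inr rfl, ?_⟩
    have h1 : ‖a + b‖ = ‖b‖ := by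
      rw [IsUltrametricDist.norm_add_eq_max_of_norm_ne_norm h.ne, max_eq_right h.le]
    have h2 : ‖a * (a + b)‖ < ‖b * b‖ := by
      rw [norm_mul, norm_mul, h1]; nlinarith [norm_nonneg a]
    rw [sub_eq_add_neg, IsUltrametricDist.norm_add_eq_max_of_norm_ne_norm (by rw [norm_neg]; exact h2.ne),
      norm_neg, max_eq_right h2.le, norm_mul, sq]
  · refine ⟨b, h.le, le_rfl, .inr rfl, ?_⟩
    by_cases hb : b = 0
    · subst hb
      have : a = 0 := by simpa using h
      simp [this]
    have h1 := norm_add_lt hb h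
    have h2 : ‖a * (a + b)‖ < ‖b * b‖ := by
      rw [norm_mul, norm_mul, h]; nlinarith [norm_pos_iff.2 hb]
    rw [sub_eq_add_neg, IsUltrametricDist.norm_add_eq_max_of_norm_ne_norm (by rw [norm_neg]; exact h2.ne),
      norm_neg, max_eq_right h2.le, norm_mul, sq]
  · refine ⟨a, le_rfl, h.le, .inl rfl, ?_⟩
    have h1 : ‖a + b‖ = ‖a‖ := by
      rw [IsUltrametricDist.norm_add_eq_max_of_norm_ne_norm h.ne', max_eq_left h.le]
    have h2 : ‖b * b‖ < ‖a * (a + b)‖ := by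
      rw [norm_mul, norm_mul, h1]; nlinarith [norm_nonneg b]
    rw [sub_eq_add_neg, IsUltrametricDist.norm_add_eq_max_of_norm_ne_norm (by rw [norm_neg]; exact h2.ne'),
      norm_neg, max_eq_left h2.le, norm_mul, h1, sq]

lemma norm_two' : ‖(2 : ℚ_[2])‖ = 2⁻¹ := by
  simpa using Padic.norm_p (p := 2)

lemma le_one_of_sq {m : ℚ_[2]} (h : ‖m‖ ^ 2 ≤ 2) : ‖m‖ ≤ 1 := by
  by_cases hm : m = 0
  · simp [hm]
  rw [Padic.norm_eq_zpow_neg_valuation hm] at h ⊢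
  push_cast at h ⊢
  by_contra hc
  rw [not_le, one_lt_zpow_iff_right₀ (by norm_num)] at hc
  have : (2:ℝ) ^ (1:ℤ) ≤ 2 ^ (-m.valuation) := zpow_le_zpow_right₀ (by norm_num) (by omega)
  rw [zpow_one] at this
  nlinarith

lemma sq_ne {m n : ℚ_[2]} (hm : m ≠ 0) : ‖m‖ ^ 2 ≠ 2⁻¹ * ‖n‖ ^ 2 := by
  intro h
  by_cases hn : n = 0
  · simp [hn, hm] at h
  rw [Padic.norm_eq_zpow_neg_valuation hm, Padic.norm_eq_zpow_neg_valuation hn] at h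
  push_cast at h
  rw [← zpow_natCast, ← zpow_natCast, ← zpow_mul, ← zpow_mul, ← zpow_neg_one,
    ← zpow_add₀ (by norm_num)] at h
  have := zpow_right_injective₀ (by norm_num) (by norm_num) h
  push_cast at this
  omega

lemma qN_le (a b c d : ℚ_[2]) :
    ‖qN (mkq a b c d)‖ ≤ 1 ↔ ‖a‖ ≤ 1 ∧ ‖b‖ ≤ 1 ∧ ‖c‖ ≤ 1 ∧ ‖d‖ ≤ 1 := by
  rw [qN_mkq]
  obtain ⟨m, ha, hb, hm, hN⟩ := norm_form a b
  obtain ⟨n, hc, hd, hn, hM⟩ := norm_form c d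
  set u := a * (a + b) - b * b
  set v := c * (c + d) - d * d
  have hv : ‖-(2 * v)‖ = 2⁻¹ * ‖n‖ ^ 2 := by rw [norm_neg, norm_mul, norm_two', hM]
  rw [sub_eq_add_neg]
  constructor
  · intro h
    have key : ‖u‖ ≤ 1 ∧ ‖-(2 * v)‖ ≤ 1 := by
      by_cases hm0 : m = 0
      · have : u = 0 := by rw [hm0] at hN; simpa using hN
        rw [this, zero_add] at h
        exact ⟨by simp [this], h⟩
      · rw [IsUltrametricDist.norm_add_eq_max_of_norm_ne_norm
          (by rw [hN, hv]; exact sq_ne hm0)] at h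
        exact max_le_iff.1 h
    have h1 : ‖m‖ ≤ 1 := le_one_of_sq (by linarith [key.1])
    have h2 : ‖n‖ ≤ 1 := le_one_of_sq (by linarith [key.2])
    exact ⟨ha.trans h1, hb.trans h1, hc.trans h2, hd.trans h2⟩
  · rintro ⟨h1, h2, h3, h4⟩
    have hm1 : ‖m‖ ≤ 1 := by rcases hm with rfl | rfl <;> assumption
    have hn1 : ‖n‖ ≤ 1 := by rcases hn with rfl | rfl <;> assumption
    refine (IsUltrametricDist.norm_add_le_max _ _).trans (max_le ?_ ?_)
    · rw [hN]; nlinarith [norm_nonneg m]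
    · rw [hv]; nlinarith [norm_nonneg n]

lemma qi_pow (s : ℕ) : qi ^ (2 * s) = algebraMap ℚ_[2] D (2 ^ s) := by
  rw [pow_mul, map_pow]
  congr 1
  rw [sq, qi, QuaternionAlgebra.algebraMap_eq]
  ext <;> simp

lemma even_mul (s : ℕ) (a b c d : ℚ_[2]) :
    qi ^ (2 * s) * mkq a b c d = mkq (2 ^ s * a) (2 ^ s * b) (2 ^ s * c) (2 ^ s * d) := by
  rw [qi_pow, mkq_eq, mkq_eq, QuaternionAlgebra.algebraMap_eq]
  ext <;> simp <;> ring

lemma odd_mul (s : ℕ) (a b c d : ℚ_[2]) :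
    qi ^ (2 * s + 1) * mkq a b c d =
      mkq (2 ^ (s + 1) * c) (2 ^ (s + 1) * d) (2 ^ s * a) (2 ^ s * b) := by
  have : qi * mkq a b c d = mkq (2 * c) (2 * d) a b := by
    rw [mkq_eq, mkq_eq, qi]
    ext <;> simp <;> ring
  rw [pow_succ, mul_assoc, this, even_mul]
  congr 1 <;> ring

lemma norm_scale (s : ℕ) (a : ℚ_[2]) : ‖2 ^ s * a‖ ≤ (2 : ℝ) ^ (-(s : ℤ)) ↔ ‖a‖ ≤ 1 := by
  rw [norm_mul, norm_pow, norm_two', zpow_neg, zpow_natCast, inv_pow]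
  have : (0:ℝ) < (2 ^ s)⁻¹ := by positivity
  constructor <;> intro h <;> nlinarith

lemma scale_ex (s : ℕ) (a : ℚ_[2]) : ∃ a', a = 2 ^ s * a' :=
  ⟨a / 2 ^ s, by field_simp⟩

/-- Coordinate description of the two-sided ideals `i^t · O_D`:
(a) `q ∈ i^(2s)·O_D` iff its coordinates in the basis `{1, ω, i, i·ω}` all lie in `2^s·ℤ₂`;
(b) `q ∈ i^(2s+1)·O_D` iff the `1, ω` coordinates lie in `2^(s+1)·ℤ₂` and the
`i, i·ω` coordinates lie in `2^s·ℤ₂`. -/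
theorem stmt_2 (s : ℕ) (q : D) :
    ((∃ p : D, ‖qN p‖ ≤ 1 ∧ q = qi ^ (2 * s) * p) ↔
      ∃ a b c d : ℚ_[2],
        ‖a‖ ≤ (2 : ℝ) ^ (-(s : ℤ)) ∧ ‖b‖ ≤ (2 : ℝ) ^ (-(s : ℤ)) ∧
        ‖c‖ ≤ (2 : ℝ) ^ (-(s : ℤ)) ∧ ‖d‖ ≤ (2 : ℝ) ^ (-(s : ℤ)) ∧
        q = algebraMap ℚ_[2] D a + algebraMap ℚ_[2] D b * qω +
            algebraMap ℚ_[2] D c * qi + algebraMap ℚ_[2] D d * (qi * qω)) ∧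
    ((∃ p : D, ‖qN p‖ ≤ 1 ∧ q = qi ^ (2 * s + 1) * p) ↔
      ∃ a b c d : ℚ_[2],
        ‖a‖ ≤ (2 : ℝ) ^ (-((s : ℤ) + 1)) ∧ ‖b‖ ≤ (2 : ℝ) ^ (-((s : ℤ) + 1)) ∧
        ‖c‖ ≤ (2 : ℝ) ^ (-(s : ℤ)) ∧ ‖d‖ ≤ (2 : ℝ) ^ (-(s : ℤ)) ∧
        q = algebraMap ℚ_[2] D a + algebraMap ℚ_[2] D b * qω +
            algebraMap ℚ_[2] D c * qi + algebraMap ℚ_[2] D d * (qi * qω)) := by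
  constructor
  · constructor
    · rintro ⟨p, hp, rfl⟩
      obtain ⟨a, b, c, d, rfl⟩ := mkq_surj p
      obtain ⟨ha, hb, hc, hd⟩ := (qN_le a b c d).1 hp
      exact ⟨_, _, _, _, (norm_scale s a).2 ha, (norm_scale s b).2 hb, (norm_scale s c).2 hc,
        (norm_scale s d).2 hd, even_mul s a b c d⟩
    · rintro ⟨a, b, c, d, ha, hb, hc, hd, rfl⟩
      obtain ⟨a, rfl⟩ := scale_ex s a
      obtain ⟨b, rfl⟩ := scale_ex s b
      obtain ⟨c, rfl⟩ := scale_ex s c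
      obtain ⟨d, rfl⟩ := scale_ex s d
      rw [norm_scale] at ha hb hc hd
      exact ⟨mkq a b c d, (qN_le a b c d).2 ⟨ha, hb, hc, hd⟩, (even_mul s a b c d).symm⟩
  · have e : -((s : ℤ) + 1) = -((s + 1 : ℕ) : ℤ) := by push_cast; rfl
    rw [e]
    constructor
    · rintro ⟨p, hp, rfl⟩
      obtain ⟨a, b, c, d, rfl⟩ := mkq_surj p
      obtain ⟨ha, hb, hc, hd⟩ := (qN_le a b c d).1 hp
      exact ⟨_, _, _, _, (norm_scale (s + 1) c).2 hc, (norm_scale (s + 1) d).2 hd,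
        (norm_scale s a).2 ha, (norm_scale s b).2 hb, odd_mul s a b c d⟩
    · rintro ⟨a, b, c, d, ha, hb, hc, hd, rfl⟩
      obtain ⟨a, rfl⟩ := scale_ex (s + 1) a
      obtain ⟨b, rfl⟩ := scale_ex (s + 1) b
      obtain ⟨c, rfl⟩ := scale_ex s c
      obtain ⟨d, rfl⟩ := scale_ex s d
      rw [norm_scale] at ha hb hc hd
      exact ⟨mkq c d a b, (qN_le c d a b).2 ⟨hc, hd, ha, hb⟩, (odd_mul s c d a b).symm⟩
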